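/- Suppose Y = F (so n = t(l+1)), H(S̄) = F_{q^t}, and 2m = t (so Orb(S) is an r-FWS code with r = tl). Then ω_{2i}(Orb(S)) = (q+1)·q^{2i−1} for every i ∈ {1,…,m−1}, and ω_{2m}(Orb(S)) = (q^n − q^{2m−1})/(q − 1). -/

import Mathlib

open Module

section Defs

variable {F : Type*} [Field F]

/-- The subspace `α·S = {α * s : s ∈ S}` of `F`, for `S` a subspace over the subfield `Fq`. -/
noncomputable def smulSub (Fq : Subfield F) (α : F) (S : Submodule Fq F) : Submodule Fq F :=
  S.map (LinearMap.mulLeft Fq α)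

/-- The one-orbit cyclic subspace code `Orb(S) = {αS : α ∈ Fˣ}`. -/
def Orb (Fq : Subfield F) (S : Submodule Fq F) : Set (Submodule Fq F) :=
  {T | ∃ α : F, α ≠ 0 ∧ T = smulSub Fq α S}

/-- The number of subspaces `αS` (for `α ∈ Fˣ`) with `dim_{Fq}(S ∩ αS) = d`.
For `dim_{Fq} S = k` and `d = k - i` this is the weight-distribution entry `ω_{2i}(Orb S)`. -/
noncomputable def wt (Fq : Subfield F) (S : Submodule Fq F) (d : ℕ) : ℕ :=
  Set.ncard {T | T ∈ Orb Fq S ∧ finrank Fq ↥(S ⊓ T) = d}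

/-- The stabilizer `H(V) = {x ∈ Fˣ : xV = V} ∪ {0}` of a set `V ⊆ F`. -/
def HStabSet (V : Set F) : Set F :=
  {x : F | x ≠ 0 ∧ (fun y => x * y) '' V = V} ∪ {0}

/-- An `Fqt`-subspace of `F` viewed as an `Fq`-subspace, for `Fq ≤ Fqt`. -/
def toFqSub (Fq Fqt : Subfield F) (h : Fq ≤ Fqt) (W : Submodule Fqt F) : Submodule Fq F where
  carrier := W
  add_mem' := fun ha hb => W.add_mem ha hb
  zero_mem' := W.zero_mem
  smul_mem' := fun c _ hx => W.smul_mem (⟨c.1, h c.2⟩ : Fqt) hx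

/-- The subfield `Fqt` viewed as an `Fq`-subspace of `F`, for `Fq ≤ Fqt`. -/
def subfieldModule (Fq Fqt : Subfield F) (h : Fq ≤ Fqt) : Submodule Fq F where
  carrier := Fqt
  add_mem' := fun ha hb => Fqt.add_mem ha hb
  zero_mem' := Fqt.zero_mem
  smul_mem' := fun c _ hx => Fqt.mul_mem (h c.2) hx

/-- `Orb(S)` is an `r`-FWS code, where `k = dim_{Fq} S`: the weight-distribution entries
`ω_{2i}` are positive for `i ∈ {1, …, k - r}` and zero for `i ∈ {k - r + 1, …, k}`. -/
def IsRFWS (Fq : Subfield F) (S : Submodule Fq F) (k r : ℕ) : Prop :=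
  (∀ i, 1 ≤ i → i ≤ k - r → 0 < wt Fq S (k - i)) ∧
  (∀ i, k - r + 1 ≤ i → i ≤ k → wt Fq S (k - i) = 0)

end Defs

open Polynomial

section PowerSpan

variable {F : Type*} [Field F] {Fq : Subfield F}

theorem mem_smulSub {α : F} (hα : α ≠ 0) {S : Submodule Fq F} {x : F} :
    x ∈ smulSub Fq α S ↔ α⁻¹ * x ∈ S := by
  constructor
  · rintro ⟨y, hy, rfl⟩
    simpa [hα] using hy
  · exact fun h => ⟨_, h, by simp [hα]⟩

/-- The span of `1, lam, …, lam ^ (M - 1)`, as the values at `lam` of polynomials of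
degree less than `M`. -/
noncomputable def powerSpan (Fq : Subfield F) (lam : F) (M : ℕ) : Submodule Fq F :=
  (degreeLT Fq M).map (aeval lam).toLinearMap

variable {lam : F}

theorem mem_powerSpan {M : ℕ} {x : F} :
    x ∈ powerSpan Fq lam M ↔ ∃ p : Fq[X], p.degree < M ∧ aeval lam p = x := by
  simp [powerSpan, mem_degreeLT]

theorem span_pow_eq_powerSpan (M : ℕ) :
    Submodule.span Fq {x : F | ∃ j < M, x = lam ^ j} = powerSpan Fq lam M := by
  classical
  rw [powerSpan, degreeLT_eq_span_X_pow, Submodule.map_span]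
  congr 1
  ext x
  simp [eq_comm]

theorem eq_zero_of_aeval_eq_zero {p : Fq[X]} (hp : p.degree < ((minpoly Fq lam).natDegree : ℕ))
    (h0 : aeval lam p = 0) : p = 0 := by
  by_contra hne
  have h := minpoly.degree_le_of_ne_zero Fq lam hne h0
  by_cases hmin : minpoly Fq lam = 0
  · rw [hmin, natDegree_zero] at hp
    exact hne (degree_eq_bot.1 (Nat.WithBot.lt_zero_iff.1 (by simpa using hp)))
  · rw [degree_eq_natDegree hmin] at h
    exact absurd hp (not_lt.2 h)

theorem finrank_map_of_injOn {k V W : Type*} [Field k] [AddCommGroup V] [Module k V]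
    [AddCommGroup W] [Module k W] (f : V →ₗ[k] W) (U : Submodule k V)
    (h : ∀ x ∈ U, f x = 0 → x = 0) : finrank k (U.map f) = finrank k U := by
  rw [← LinearMap.range_domRestrict]
  refine LinearMap.finrank_range_of_inj ?_
  rw [← LinearMap.ker_eq_bot, LinearMap.ker_eq_bot']
  intro x hx
  exact Subtype.ext (h x x.2 hx)

theorem finrank_degreeLT (k : Type*) [Field k] (M : ℕ) : finrank k (degreeLT k M) = M := by
  rw [(degreeLTEquiv k M).finrank_eq, finrank_fin_fun]

instance finite_degreeLT (k : Type*) [Field k] (M : ℕ) : Module.Finite k (degreeLT k M) :=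
  Module.Finite.equiv (degreeLTEquiv k M).symm

instance finite_powerSpan (M : ℕ) : Module.Finite Fq (powerSpan Fq lam M) := by
  unfold powerSpan; infer_instance

theorem finrank_powerSpan {M : ℕ} (hM : M ≤ (minpoly Fq lam).natDegree) :
    finrank Fq (powerSpan Fq lam M) = M := by
  rw [powerSpan, finrank_map_of_injOn, finrank_degreeLT]
  intro p hp h0
  exact eq_zero_of_aeval_eq_zero ((mem_degreeLT.1 hp).trans_le (by exact_mod_cast hM)) h0

/-- If `α = f(lam) / g(lam)` in lowest terms, then the intersection of the power span of
length `M` with its multiple by `α` has dimension `M - max (deg f) (deg g)`. -/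
theorem finrank_powerSpan_inf_smulSub {m M : ℕ} (hm : 2 * m ≤ (minpoly Fq lam).natDegree)
    (hM : M ≤ m) {α : F} (hα : α ≠ 0) {f g : Fq[X]} (hf : f ≠ 0) (hg : g ≠ 0)
    (hfg : IsCoprime f g) (hfm : f.natDegree < m) (hgm : g.natDegree < m)
    (h : aeval lam f = α * aeval lam g) :
    finrank Fq ↥(powerSpan Fq lam M ⊓ smulSub Fq α (powerSpan Fq lam M)) =
      M - max f.natDegree g.natDegree := by
  set d := max f.natDegree g.natDegree with hd
  have hfd : f.natDegree ≤ d := le_max_left _ _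
  have hgd : g.natDegree ≤ d := le_max_right _ _
  have hmul : ∀ p ∈ degreeLT Fq (M - d), ∀ r : Fq[X], r.natDegree ≤ d → (p * r).degree < M := by
    intro p hp r hr
    by_cases hp0 : p = 0
    · simp [hp0]
    by_cases hr0 : r = 0
    · simp [hr0]
    rw [mem_degreeLT, ← natDegree_lt_iff_degree_lt hp0] at hp
    rw [← natDegree_lt_iff_degree_lt (mul_ne_zero hp0 hr0), natDegree_mul hp0 hr0]
    omega
  have key : powerSpan Fq lam M ⊓ smulSub Fq α (powerSpan Fq lam M) =
      (degreeLT Fq (M - d)).map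
        ((aeval lam).toLinearMap ∘ₗ LinearMap.mulRight Fq f) := by
    ext x
    rw [Submodule.mem_inf, mem_smulSub hα, mem_powerSpan, mem_powerSpan]
    constructor
    · rintro ⟨⟨u, hu, rfl⟩, v, hv, huv⟩
      have huv' : aeval lam u = α * aeval lam v := by rw [huv, mul_inv_cancel_left₀ hα]
      have hpoly : u * g - f * v = 0 := by
        apply eq_zero_of_aeval_eq_zero (lam := lam)
        · have hdeg : ∀ a b : Fq[X], a.degree < M → b.natDegree < m →
              (a * b).degree < ((minpoly Fq lam).natDegree : ℕ) := by
            intro a b ha hb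
            by_cases ha0 : a = 0
            · simp [ha0]
            by_cases hb0 : b = 0
            · simp [hb0]
            rw [← natDegree_lt_iff_degree_lt ha0] at ha
            rw [← natDegree_lt_iff_degree_lt (mul_ne_zero ha0 hb0), natDegree_mul ha0 hb0]
            omega
          refine (degree_sub_le _ _).trans_lt (max_lt (hdeg u g hu hgm) ?_)
          rw [mul_comm]
          exact hdeg v f hv hfm
        · rw [map_sub, map_mul, map_mul, huv', h]; ring
      have hdvd : f ∣ u := hfg.dvd_of_dvd_mul_right ⟨v, sub_eq_zero.1 hpoly⟩
      obtain ⟨p, rfl⟩ := hdvd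
      have hvp : v = p * g := by
        apply mul_left_cancel₀ hf
        rw [← sub_eq_zero.1 hpoly]; ring
      subst hvp
      refine ⟨p, ?_, by simp [mul_comm]⟩
      by_cases hp0 : p = 0
      · simp [hp0]
      rw [← natDegree_lt_iff_degree_lt (mul_ne_zero hf hp0), natDegree_mul hf hp0] at hu
      rw [← natDegree_lt_iff_degree_lt (mul_ne_zero hp0 hg), natDegree_mul hp0 hg] at hv
      rw [SetLike.mem_coe, mem_degreeLT, ← natDegree_lt_iff_degree_lt hp0]
      omega
    · rintro ⟨p, hp, rfl⟩
      refine ⟨⟨p * f, hmul p hp f hfd, by simp⟩, p * g, hmul p hp g hgd, ?_⟩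
      simp only [LinearMap.comp_apply, LinearMap.mulRight_apply, AlgHom.toLinearMap_apply,
        map_mul, h]
      field_simp
  rw [key, finrank_map_of_injOn, finrank_degreeLT]
  intro p hp h0
  refine (mul_eq_zero.1 (eq_zero_of_aeval_eq_zero (lam := lam) (p := p * f) ?_ h0)).resolve_right hf
  exact (hmul p hp f hfd).trans_le (by exact_mod_cast (by omega))

theorem exists_finrank_powerSpan_inf_smulSub {m : ℕ}
    (hm : 2 * m ≤ (minpoly Fq lam).natDegree) {α : F} (hα : α ≠ 0) :
    ∃ d ≤ m, ∀ M ≤ m,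
      finrank Fq ↥(powerSpan Fq lam M ⊓ smulSub Fq α (powerSpan Fq lam M)) = M - d := by
  classical
  by_cases hex : ∃ f g : Fq[X], f ≠ 0 ∧ f.degree < m ∧ g.degree < m ∧
      aeval lam f = α * aeval lam g
  · obtain ⟨f, g, hf, hfm, hgm, h⟩ := hex
    have hinj : ∀ p : Fq[X], p ≠ 0 → p.natDegree < m → aeval lam p ≠ 0 := fun p hp hpm h0 =>
      hp (eq_zero_of_aeval_eq_zero ((natDegree_lt_iff_degree_lt hp).1 (by omega)) h0)
    have hg : g ≠ 0 := by
      rintro rfl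
      exact hinj f hf ((natDegree_lt_iff_degree_lt hf).2 hfm) (by simpa using h)
    rw [← natDegree_lt_iff_degree_lt hf] at hfm
    rw [← natDegree_lt_iff_degree_lt hg] at hgm
    obtain ⟨f', g', hf', hg', hu⟩ := extract_gcd f g
    rw [gcd_isUnit_iff] at hu
    generalize gcd f g = c at hf' hg'
    subst hf' hg'
    have hc := left_ne_zero_of_mul hf
    have hf0 := right_ne_zero_of_mul hf
    have hg0 := right_ne_zero_of_mul hg
    rw [natDegree_mul hc hf0] at hfm
    rw [natDegree_mul hc hg0] at hgm
    have hc0 := hinj c hc (by omega)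
    refine ⟨max f'.natDegree g'.natDegree, by omega, fun M hM => ?_⟩
    refine finrank_powerSpan_inf_smulSub hm hM hα hf0 hg0 hu (by omega) (by omega) ?_
    apply mul_left_cancel₀ hc0
    rw [← map_mul, h, map_mul]; ring
  · refine ⟨m, le_rfl, fun M hM => ?_⟩
    have hbot : powerSpan Fq lam M ⊓ smulSub Fq α (powerSpan Fq lam M) = ⊥ := by
      rw [eq_bot_iff]
      intro x hx
      rw [Submodule.mem_inf, mem_smulSub hα, mem_powerSpan, mem_powerSpan] at hx
      obtain ⟨⟨u, hu, rfl⟩, v, hv, huv⟩ := hx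
      rw [Submodule.mem_bot]
      by_contra hne
      have hM' : (M : WithBot ℕ) ≤ m := by exact_mod_cast hM
      exact hex ⟨u, v, fun h => hne (by simp [h]), hu.trans_le hM', hv.trans_le hM',
        by rw [huv, mul_inv_cancel_left₀ hα]⟩
    rw [hbot, finrank_bot]; omega

theorem mem_of_finrank_powerSpan_inf_smulSub_eq {m : ℕ} (hm0 : 0 < m)
    (hm : 2 * m ≤ (minpoly Fq lam).natDegree) {α : F} (hα : α ≠ 0)
    (h : finrank Fq ↥(powerSpan Fq lam m ⊓ smulSub Fq α (powerSpan Fq lam m)) = m) :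
    α ∈ Fq := by
  obtain ⟨d, hd, hM⟩ := exists_finrank_powerSpan_inf_smulSub hm hα
  have hd0 : d = 0 := by have := hM m le_rfl; omega
  have h1 := hM 1 hm0
  have hne : powerSpan Fq lam 1 ⊓ smulSub Fq α (powerSpan Fq lam 1) ≠ ⊥ := by
    intro hbot
    rw [hbot, finrank_bot, hd0] at h1
    omega
  obtain ⟨x, hx, hx0⟩ := Submodule.exists_mem_ne_zero_of_ne_bot hne
  rw [Submodule.mem_inf, mem_smulSub hα, mem_powerSpan, mem_powerSpan] at hx
  obtain ⟨⟨u, hu, rfl⟩, v, hv, huv⟩ := hx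
  have hconst : ∀ p : Fq[X], p.degree < (1 : ℕ) → aeval lam p ∈ Fq := by
    intro p hp
    rw [eq_C_of_degree_le_zero (p := p) (Nat.WithBot.lt_one_iff_le_zero.1 (by simpa using hp)),
      aeval_C]
    exact (p.coeff 0).2
  have hv0 : aeval lam v ≠ 0 := by rw [huv]; exact mul_ne_zero (inv_ne_zero hα) hx0
  have : α = aeval lam u / aeval lam v := by rw [huv]; field_simp
  rw [this]
  exact Fq.div_mem (hconst u hu) (hconst v hv)

end PowerSpan

section Counting

variable {F : Type*} [Field F] {Fq : Subfield F} {lam : F}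

open scoped Classical in
theorem card_nonzero_submodule [Fintype F] (U : Submodule Fq F) :
    ((Finset.univ.filter fun x : F => x ≠ 0 ∧ x ∈ U).card : ℤ) =
      (Nat.card Fq : ℤ) ^ finrank Fq U - 1 := by
  have h : (Finset.univ.filter fun x : F => x ≠ 0 ∧ x ∈ U) =
      (Finset.univ.filter fun x : F => x ∈ U).erase 0 := by
    ext x; simp
  have hcard : (Finset.univ.filter fun x : F => x ∈ U).card = Nat.card Fq ^ finrank Fq U := by
    rw [← Module.natCard_eq_pow_finrank (K := Fq) (V := U), Nat.card_eq_fintype_card,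
      Fintype.card_subtype]
  rw [h, Finset.cast_card_erase_of_mem (by simp), hcard]
  push_cast
  rfl

open scoped Classical in
/-- Counting the pairs of nonzero elements of `U` by their quotient. -/
theorem sum_card_inf_smulSub [Fintype F] (U : Submodule Fq F) :
    ∑ α ∈ Finset.univ.filter (fun α : F => α ≠ 0),
        ((Nat.card Fq : ℤ) ^ finrank Fq ↥(U ⊓ smulSub Fq α U) - 1) =
      ((Nat.card Fq : ℤ) ^ finrank Fq U - 1) ^ 2 := by
  set A := Finset.univ.filter fun x : F => x ≠ 0 ∧ x ∈ U with hA
  have hmaps : Set.MapsTo (fun p : F × F => p.1 / p.2) ↑(A ×ˢ A)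
      ↑(Finset.univ.filter (fun α : F => α ≠ 0)) := by
    rintro ⟨x, y⟩ h
    simp only [hA, Finset.coe_product, Set.mem_prod, Finset.mem_coe, Finset.mem_filter,
      Finset.mem_univ, true_and] at h ⊢
    exact div_ne_zero h.1.1 h.2.1
  have h := Finset.card_eq_sum_card_fiberwise hmaps
  rw [sq, ← card_nonzero_submodule U, ← Nat.cast_mul, ← Finset.card_product, h, Nat.cast_sum]
  refine Finset.sum_congr rfl fun α hα => ?_
  have hα0 : α ≠ 0 := by simpa using hα
  rw [← card_nonzero_submodule, Nat.cast_inj]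
  refine Finset.card_bij' (fun x _ => (x, α⁻¹ * x)) (fun p _ => p.1) ?_ ?_ ?_ ?_
  · intro x hx
    simp only [Finset.mem_filter, Finset.mem_univ, true_and, Submodule.mem_inf,
      mem_smulSub hα0] at hx
    obtain ⟨hx0, hxU, hxα⟩ := hx
    simp only [hA, Finset.mem_filter, Finset.mem_product, Finset.mem_univ, true_and]
    refine ⟨⟨⟨hx0, hxU⟩, mul_ne_zero (inv_ne_zero hα0) hx0, hxα⟩, ?_⟩
    field_simp
  · rintro ⟨x, y⟩ h
    simp only [hA, Finset.mem_filter, Finset.mem_product, Finset.mem_univ, true_and] at h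
    obtain ⟨⟨⟨hx0, hxU⟩, hy0, hyU⟩, rfl⟩ := h
    simp only [Finset.mem_filter, Finset.mem_univ, true_and, Submodule.mem_inf,
      mem_smulSub hα0]
    refine ⟨hx0, hxU, ?_⟩
    rwa [inv_div, div_mul_cancel₀ _ hx0]
  · intro x _
    rfl
  · rintro ⟨x, y⟩ h
    simp only [hA, Finset.mem_filter, Finset.mem_product, Finset.mem_univ, true_and] at h
    obtain ⟨⟨⟨hx0, hxU⟩, hy0, hyU⟩, rfl⟩ := h
    simp [inv_div, div_mul_cancel₀ _ hx0]

open scoped Classical in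
/-- The number of `α ≠ 0` of height less than `j`, that is, of quotients of two nonzero
polynomials in `lam` of degree less than `j`. -/
theorem card_lt_finrank_powerSpan_inf [Fintype F] {m j : ℕ}
    (hm : 2 * m ≤ (minpoly Fq lam).natDegree) (hj0 : 0 < j) (hj : j ≤ m) :
    ((Finset.univ.filter fun α : F => α ≠ 0 ∧
        m < finrank Fq ↥(powerSpan Fq lam m ⊓ smulSub Fq α (powerSpan Fq lam m)) + j).card : ℤ) =
      (Nat.card Fq : ℤ) ^ (2 * j - 1) - 1 := by
  obtain ⟨r, rfl⟩ : ∃ r, j = r + 1 := ⟨j - 1, by omega⟩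
  set q : ℤ := (Nat.card Fq : ℤ) with hq
  have hq1 : q - 1 ≠ 0 := by
    have : 1 < Nat.card Fq := Finite.one_lt_card
    have : (1 : ℤ) < q := by rw [hq]; exact_mod_cast this
    omega
  have e1 := sum_card_inf_smulSub (powerSpan Fq lam (r + 1))
  have e0 := sum_card_inf_smulSub (powerSpan Fq lam r)
  rw [finrank_powerSpan (by omega)] at e1 e0
  have hterm : ∀ α ∈ Finset.univ.filter (fun α : F => α ≠ 0),
      (q ^ finrank Fq ↥(powerSpan Fq lam (r + 1) ⊓ smulSub Fq α (powerSpan Fq lam (r + 1))) - 1)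
        - q * (q ^ finrank Fq ↥(powerSpan Fq lam r ⊓ smulSub Fq α (powerSpan Fq lam r)) - 1) =
      (q - 1) * if m < finrank Fq
        ↥(powerSpan Fq lam m ⊓ smulSub Fq α (powerSpan Fq lam m)) + (r + 1) then 1 else 0 := by
    intro α hα
    obtain ⟨d, hd, hM⟩ := exists_finrank_powerSpan_inf_smulSub hm (by simpa using hα : α ≠ 0)
    rw [hM (r + 1) hj, hM r (by omega), hM m le_rfl]
    split_ifs with h
    · rw [show r + 1 - d = (r - d) + 1 by omega]
      ring
    · rw [show r + 1 - d = 0 by omega, show r - d = 0 by omega]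
      ring
  have hsum := Finset.sum_congr rfl hterm
  rw [Finset.sum_sub_distrib, ← Finset.mul_sum, ← Finset.mul_sum, e1, e0, Finset.sum_boole,
    Finset.filter_filter] at hsum
  apply mul_left_cancel₀ hq1
  rw [← hsum, show 2 * (r + 1) - 1 = r + r + 1 by omega]
  ring

theorem smulSub_inv_mul_eq_self {S : Submodule Fq F} {α β : F} (hα : α ≠ 0) (hβ : β ≠ 0)
    (h : smulSub Fq β S = smulSub Fq α S) : smulSub Fq (α⁻¹ * β) S = S := by
  ext x
  have hx := SetLike.ext_iff.1 h (α * x)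
  rw [mem_smulSub hβ, mem_smulSub hα, inv_mul_cancel_left₀ hα] at hx
  rw [mem_smulSub (mul_ne_zero (inv_ne_zero hα) hβ), ← hx, mul_inv, inv_inv]
  ring_nf

/-- Each element `α S` of the orbit comes from exactly `q - 1` scalars `α`. -/
theorem wt_mul_card_sub_one [Fintype F] (S : Submodule Fq F)
    (hstab : ∀ γ : F, γ ≠ 0 → smulSub Fq γ S = S → γ ∈ Fq) (v : ℕ) :
    (wt Fq S v : ℤ) * ((Nat.card Fq : ℤ) - 1) =
      ({α : F | α ≠ 0 ∧ finrank Fq ↥(S ⊓ smulSub Fq α S) = v}.ncard : ℤ) := by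
  classical
  set A := Finset.univ.filter fun α : F => α ≠ 0 ∧ finrank Fq ↥(S ⊓ smulSub Fq α S) = v with hA
  have hset : {T | T ∈ Orb Fq S ∧ finrank Fq ↥(S ⊓ T) = v} =
      ↑(A.image fun α => smulSub Fq α S) := by
    ext T
    simp only [Orb, Set.mem_ofPred_eq, hA, Finset.coe_image, Finset.coe_filter, Finset.mem_univ,
      true_and, Set.mem_image]
    constructor
    · rintro ⟨⟨α, hα, rfl⟩, h⟩
      exact ⟨α, ⟨hα, h⟩, rfl⟩
    · rintro ⟨α, ⟨hα, h⟩, rfl⟩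
      exact ⟨⟨α, hα, rfl⟩, h⟩
  have hset' : {α : F | α ≠ 0 ∧ finrank Fq ↥(S ⊓ smulSub Fq α S) = v} = ↑A := by simp [hA]
  rw [wt, hset, hset', Set.ncard_coe_finset, Set.ncard_coe_finset,
    Finset.card_eq_sum_card_image (fun α => smulSub Fq α S) A, Nat.cast_sum]
  rw [Finset.sum_congr rfl (g := fun _ => (Nat.card Fq : ℤ) - 1), Finset.sum_const, nsmul_eq_mul]
  intro T hT
  obtain ⟨α, hα, rfl⟩ := Finset.mem_image.1 hT
  have hα' := hα
  simp only [hA, Finset.mem_filter, Finset.mem_univ, true_and] at hα'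
  have hunits := card_nonzero_submodule (Fq := Fq) (1 : Submodule Fq F)
  have hone : finrank Fq (1 : Submodule Fq F) = 1 := by
    rw [Submodule.one_eq_span]
    exact finrank_span_singleton one_ne_zero
  have hmem : ∀ x : F, x ∈ (1 : Submodule Fq F) ↔ x ∈ Fq := by
    intro x
    rw [Submodule.mem_one]
    exact ⟨fun ⟨y, hy⟩ => hy ▸ y.2, fun h => ⟨⟨x, h⟩, rfl⟩⟩
  rw [hone, pow_one] at hunits
  rw [← hunits, Nat.cast_inj]
  have hsmul : ∀ γ : F, γ ≠ 0 → γ ∈ Fq → smulSub Fq (α * γ) S = smulSub Fq α S := by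
    intro γ hγ hγF
    ext x
    rw [mem_smulSub (mul_ne_zero hα'.1 hγ), mem_smulSub hα'.1]
    have hsm : α⁻¹ * x = (⟨γ, hγF⟩ : Fq) • ((α * γ)⁻¹ * x) := by
      change _ = γ * _
      field_simp
    have hγ' : (⟨γ, hγF⟩ : Fq) ≠ 0 := fun h => hγ (congrArg Subtype.val h)
    rw [hsm]
    exact (S.smul_mem_iff hγ').symm
  refine Finset.card_bij' (fun β _ => α⁻¹ * β) (fun γ _ => α * γ) ?_ ?_ ?_ ?_
  · intro β hβ
    simp only [hA, Finset.mem_filter, Finset.mem_univ, true_and] at hβ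
    obtain ⟨⟨hβ0, -⟩, hβS⟩ := hβ
    have hne : α⁻¹ * β ≠ 0 := mul_ne_zero (inv_ne_zero hα'.1) hβ0
    simp only [Finset.mem_filter, Finset.mem_univ, true_and, hmem]
    refine ⟨hne, hstab _ hne (smulSub_inv_mul_eq_self hα'.1 hβ0 hβS)⟩
  · intro γ hγ
    simp only [Finset.mem_filter, Finset.mem_univ, true_and, hmem] at hγ
    simp only [hA, Finset.mem_filter, Finset.mem_univ, true_and]
    rw [hsmul γ hγ.1 hγ.2]
    exact ⟨⟨mul_ne_zero hα'.1 hγ.1, hα'.2⟩, rfl⟩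
  · intro β _
    exact mul_inv_cancel_left₀ hα'.1 β
  · intro γ _
    exact inv_mul_cancel_left₀ hα'.1 γ

end Counting

section Hyperplane

universe u

theorem rank_comap_eq {k : Type*} {V W : Type u} [Field k] [AddCommGroup V] [Module k V]
    [AddCommGroup W] [Module k W] (g : V →ₗ[k] W) (U : Submodule k W)
    (hU : U ≤ LinearMap.range g) :
    Module.rank k (U.comap g) = Module.rank k U + Module.rank k (LinearMap.ker g) := by
  rw [← LinearMap.rank_range_add_rank_ker (g.domRestrict (U.comap g)),
    LinearMap.range_domRestrict, Submodule.map_comap_eq, inf_eq_right.2 hU,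
    LinearMap.ker_domRestrict,
    (Submodule.comapSubtypeEquivOfLe (LinearMap.ker_le_comap g)).rank_eq]

theorem rank_submodule_prod {k : Type*} {V : Type u} [Field k] [AddCommGroup V] [Module k V]
    (U U' : Submodule k V) :
    Module.rank k (U.prod U') = Module.rank k U + Module.rank k U' := by
  let e : (U.prod U') ≃ₗ[k] U × U' :=
    { toFun := fun x => (⟨x.1.1, x.2.1⟩, ⟨x.1.2, x.2.2⟩)
      invFun := fun y => ⟨(y.1, y.2), y.1.2, y.2.2⟩
      map_add' := fun _ _ => rfl
      map_smul' := fun _ _ => rfl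
      left_inv := fun _ => rfl
      right_inv := fun _ => rfl }
  rw [e.rank_eq, rank_prod']

variable {F : Type u} [Field F] {Fq : Subfield F} {K : Type u} [Field K] [Algebra Fq K]
  [Algebra K F] [IsScalarTower Fq K F]

/-- The preimage of an `Fq`-subspace `U` of `F` under a `K`-linear functional on `F`. -/
noncomputable def functionalComap (φ : F →ₗ[K] K) (U : Submodule Fq F) : Submodule Fq F :=
  U.comap ((Algebra.linearMap K F ∘ₗ φ).restrictScalars Fq)

theorem mem_functionalComap {φ : F →ₗ[K] K} {U : Submodule Fq F} {x : F} :
    x ∈ functionalComap φ U ↔ algebraMap K F (φ x) ∈ U := Iff.rfl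

variable {φ : F →ₗ[K] K} {U : Submodule Fq F} {l : ℕ}

theorem rank_ker_restrictScalars {W : Type u} [AddCommGroup W] [Module K W] [Module Fq W]
    [IsScalarTower Fq K W]
    (g : F →ₗ[K] W) [Module.Finite K (LinearMap.ker g)] :
    Module.rank Fq (LinearMap.ker (g.restrictScalars Fq)) =
      Module.rank Fq K * (finrank K (LinearMap.ker g) : Cardinal) := by
  rw [finrank_eq_rank]
  exact (rank_mul_rank Fq K (LinearMap.ker g)).symm

theorem rank_functionalComap_inf_of_mem (hφ : Function.Surjective φ)
    [Module.Finite K (LinearMap.ker φ)] (hl : finrank K (LinearMap.ker φ) = l)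
    (hU : ∀ x ∈ U, x ∈ Set.range (algebraMap K F)) {α : F} (hα : α ≠ 0)
    (hαK : α ∈ Set.range (algebraMap K F)) :
    Module.rank Fq ↥(functionalComap φ U ⊓ smulSub Fq α (functionalComap φ U)) =
      Module.rank Fq ↥(U ⊓ smulSub Fq α U) + Module.rank Fq K * (l : Cardinal) := by
  have heq : functionalComap φ U ⊓ smulSub Fq α (functionalComap φ U) =
      (U ⊓ smulSub Fq α U).comap ((Algebra.linearMap K F ∘ₗ φ).restrictScalars Fq) := by
    obtain ⟨a, rfl⟩ := hαK
    ext x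
    rw [Submodule.mem_comap, Submodule.mem_inf, Submodule.mem_inf, mem_smulSub hα, mem_smulSub hα,
      mem_functionalComap, mem_functionalComap]
    have : (algebraMap K F a)⁻¹ * x = a⁻¹ • x := by rw [Algebra.smul_def, map_inv₀]
    rw [this, map_smul, smul_eq_mul, map_mul, map_inv₀]
    rfl
  have hker : LinearMap.ker (Algebra.linearMap K F ∘ₗ φ) = LinearMap.ker φ :=
    LinearMap.ker_comp_of_ker_eq_bot _ (LinearMap.ker_eq_bot.2 (algebraMap K F).injective)
  rw [heq, rank_comap_eq]
  · have : Module.Finite K (LinearMap.ker (Algebra.linearMap K F ∘ₗ φ)) := by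
      rw [hker]; infer_instance
    rw [rank_ker_restrictScalars, hker, hl]
  · intro x hx
    obtain ⟨a, rfl⟩ := hU x hx.1
    obtain ⟨y, rfl⟩ := hφ a
    exact ⟨y, rfl⟩

theorem surjective_prod_of_notMem [Module.Finite K F]
    (hφ : Function.Surjective φ)
    {α : F} (hα : α ≠ 0)
    (hstab : ¬ ∀ x, φ (α⁻¹ * x) = 0 ↔ φ x = 0) :
    Function.Surjective (φ.prod (φ ∘ₗ LinearMap.mulLeft K α⁻¹)) := by
  have hex : ∃ x, φ x = 0 ∧ φ (α⁻¹ * x) ≠ 0 := by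
    by_contra! hcon
    apply hstab
    have hle : LinearMap.ker φ ≤ LinearMap.ker (φ ∘ₗ LinearMap.mulLeft K α⁻¹) :=
      fun x hx => hcon x hx
    have hsurj : Function.Surjective (φ ∘ₗ LinearMap.mulLeft K α⁻¹) := by
      intro a
      obtain ⟨y, rfl⟩ := hφ a
      exact ⟨α * y, by simp [hα]⟩
    have h1 := LinearMap.finrank_range_add_finrank_ker φ
    have h2 := LinearMap.finrank_range_add_finrank_ker (φ ∘ₗ LinearMap.mulLeft K α⁻¹)
    rw [LinearMap.range_eq_top.2 hφ] at h1
    rw [LinearMap.range_eq_top.2 hsurj] at h2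
    have heq := Submodule.eq_of_le_of_finrank_eq hle (by omega)
    intro x
    exact (SetLike.ext_iff.1 heq x).symm
  obtain ⟨x, hx0, hx1⟩ := hex
  rintro ⟨a, c⟩
  obtain ⟨y, rfl⟩ := hφ a
  refine ⟨y + ((c - φ (α⁻¹ * y)) / φ (α⁻¹ * x)) • x, ?_⟩
  simp [hx0, mul_add, hx1]

theorem rank_functionalComap_inf_of_notMem [Module.Finite K F]
    (hφ : Function.Surjective φ) (hl : finrank K (LinearMap.ker φ) = l)
    (hU : ∀ x ∈ U, x ∈ Set.range (algebraMap K F)) {α : F} (hα : α ≠ 0)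
    (hstab : ¬ ∀ x, φ (α⁻¹ * x) = 0 ↔ φ x = 0) :
    Module.rank Fq ↥(functionalComap φ U ⊓ smulSub Fq α (functionalComap φ U)) =
      Module.rank Fq U + Module.rank Fq U + Module.rank Fq K * ((l - 1 : ℕ) : Cardinal) := by
  have hsurj := surjective_prod_of_notMem hφ hα hstab
  set g := φ.prod (φ ∘ₗ LinearMap.mulLeft K α⁻¹) with hg
  set j : K × K →ₗ[K] F × F := (Algebra.linearMap K F).prodMap (Algebra.linearMap K F) with hj
  have hjinj : LinearMap.ker j = ⊥ := by
    rw [LinearMap.ker_eq_bot]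
    exact Function.Injective.prodMap (algebraMap K F).injective (algebraMap K F).injective
  have heq : functionalComap φ U ⊓ smulSub Fq α (functionalComap φ U) =
      (U.prod U).comap ((j ∘ₗ g).restrictScalars Fq) := by
    ext x
    rw [Submodule.mem_comap, Submodule.mem_inf, mem_smulSub hα,
      mem_functionalComap, mem_functionalComap]
    rfl
  have hker : LinearMap.ker (j ∘ₗ g) = LinearMap.ker g := LinearMap.ker_comp_of_ker_eq_bot _ hjinj
  have hfin : finrank K (LinearMap.ker g) = l - 1 := by
    have h1 := LinearMap.finrank_range_add_finrank_ker φ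
    have h2 := LinearMap.finrank_range_add_finrank_ker g
    rw [LinearMap.range_eq_top.2 hφ, finrank_top, finrank_self] at h1
    rw [LinearMap.range_eq_top.2 hsurj, finrank_top, finrank_prod, finrank_self] at h2
    omega
  rw [heq, rank_comap_eq, rank_ker_restrictScalars, hker, hfin, rank_submodule_prod]
  intro x hx
  obtain ⟨a, ha⟩ := hU x.1 hx.1
  obtain ⟨c, hc⟩ := hU x.2 hx.2
  obtain ⟨y, hy⟩ := hsurj (a, c)
  refine ⟨y, ?_⟩
  change j (g y) = x
  rw [hy]
  exact Prod.ext ha hc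

end Hyperplane

section Weights

universe u

variable {F : Type u} [Field F] {Fq : Subfield F} {K : Type u} [Field K] [Algebra Fq K]
  [Algebra K F] [IsScalarTower Fq K F] {φ : F →ₗ[K] K} {lam : F} {l m : ℕ}

theorem powerSpan_subset_range (hlam : lam ∈ Set.range (algebraMap K F)) (M : ℕ) :
    ∀ x ∈ powerSpan Fq lam M, x ∈ Set.range (algebraMap K F) := by
  intro x hx
  obtain ⟨p, -, rfl⟩ := mem_powerSpan.1 hx
  obtain ⟨a, rfl⟩ := hlam
  exact ⟨aeval a p, (aeval_algebraMap_apply F a p).symm⟩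

theorem add_mem_range_algebraMap_iff {x : F} (c : Fq) :
    x + c ∈ Set.range (algebraMap K F) ↔ x ∈ Set.range (algebraMap K F) := by
  have hc : algebraMap K F (algebraMap Fq K c) = c :=
    (IsScalarTower.algebraMap_apply Fq K F c).symm
  constructor
  · rintro ⟨y, hy⟩
    exact ⟨y - algebraMap Fq K c, by rw [map_sub, hy, hc]; ring⟩
  · rintro ⟨y, rfl⟩
    exact ⟨y + algebraMap Fq K c, by rw [map_add, hc]⟩

theorem coe_mem_range_algebraMap (c : Fq) : (c : F) ∈ Set.range (algebraMap K F) :=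
  ⟨algebraMap Fq K c, (IsScalarTower.algebraMap_apply Fq K F c).symm⟩

theorem mem_of_smulSub_functionalComap_eq [Module.Finite K F] (hφ : Function.Surjective φ)
    (hstab : ∀ α : F, α ≠ 0 → α ∉ Set.range (algebraMap K F) →
      ¬ ∀ x, φ (α⁻¹ * x) = 0 ↔ φ x = 0)
    (hlam : lam ∈ Set.range (algebraMap K F)) (hm0 : 0 < m)
    (hm : 2 * m ≤ (minpoly Fq lam).natDegree) {γ : F} (hγ : γ ≠ 0)
    (h : smulSub Fq γ (functionalComap φ (powerSpan Fq lam m)) =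
      functionalComap φ (powerSpan Fq lam m)) : γ ∈ Fq := by
  have hmem : ∀ x, algebraMap K F (φ (γ⁻¹ * x)) ∈ powerSpan Fq lam m ↔
      algebraMap K F (φ x) ∈ powerSpan Fq lam m := by
    intro x
    rw [← mem_functionalComap, ← mem_functionalComap, ← mem_smulSub hγ, h]
  by_cases hγK : γ ∈ Set.range (algebraMap K F)
  · have hle : powerSpan Fq lam m ≤ smulSub Fq γ (powerSpan Fq lam m) := by
      intro x hx
      obtain ⟨a, rfl⟩ := powerSpan_subset_range hlam m x hx
      obtain ⟨y, rfl⟩ := hφ a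
      obtain ⟨c, rfl⟩ := hγK
      have hy := (hmem y).2 hx
      rw [← map_inv₀, ← Algebra.smul_def, map_smul, smul_eq_mul, map_mul, map_inv₀] at hy
      exact (mem_smulSub hγ).2 hy
    refine mem_of_finrank_powerSpan_inf_smulSub_eq hm0 hm hγ ?_
    rw [inf_eq_left.2 hle, finrank_powerSpan (by omega)]
  · exfalso
    have hnle : ¬ powerSpan Fq lam (m + 1) ≤ powerSpan Fq lam m := by
      intro hle
      have := Submodule.finrank_mono hle
      rw [finrank_powerSpan (by omega), finrank_powerSpan (by omega)] at this
      omega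
    obtain ⟨x, hx, hxm⟩ := SetLike.not_le_iff_exists.1 hnle
    obtain ⟨a, rfl⟩ := powerSpan_subset_range hlam (m + 1) x hx
    obtain ⟨y, hy⟩ := surjective_prod_of_notMem hφ hγ (hstab γ hγ hγK) (a, 0)
    have hy1 : φ y = a := congrArg Prod.fst hy
    have hy2 : φ (γ⁻¹ * y) = 0 := congrArg Prod.snd hy
    apply hxm
    rw [← hy1, ← hmem, hy2, map_zero]
    exact Submodule.zero_mem _

theorem finrank_functionalComap_inf [Module.Finite K F] [Module.Finite Fq K]
    (hφ : Function.Surjective φ) (hker : finrank K (LinearMap.ker φ) = l) (hl : 0 < l)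
    (hstab : ∀ α : F, α ≠ 0 → α ∉ Set.range (algebraMap K F) →
      ¬ ∀ x, φ (α⁻¹ * x) = 0 ↔ φ x = 0)
    (hlam : lam ∈ Set.range (algebraMap K F)) (hm : 2 * m = (minpoly Fq lam).natDegree)
    (hK : finrank Fq K = 2 * m) {α : F} (hα : α ≠ 0) :
    finrank Fq ↥(functionalComap φ (powerSpan Fq lam m) ⊓
        smulSub Fq α (functionalComap φ (powerSpan Fq lam m))) =
      2 * m * l + finrank Fq ↥(powerSpan Fq lam m ⊓ smulSub Fq α (powerSpan Fq lam m)) := by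
  by_cases hαK : α ∈ Set.range (algebraMap K F)
  · apply finrank_eq_of_rank_eq
    rw [rank_functionalComap_inf_of_mem hφ hker (powerSpan_subset_range hlam m) hα hαK,
      ← finrank_eq_rank, ← finrank_eq_rank, hK]
    push_cast
    ring
  · have hbot : powerSpan Fq lam m ⊓ smulSub Fq α (powerSpan Fq lam m) = ⊥ := by
      rw [eq_bot_iff]
      intro x hx
      rw [Submodule.mem_inf, mem_smulSub hα] at hx
      obtain ⟨a, ha⟩ := powerSpan_subset_range hlam m _ hx.1
      obtain ⟨c, hc⟩ := powerSpan_subset_range hlam m _ hx.2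
      rw [Submodule.mem_bot]
      by_contra hx0
      refine hαK ⟨a / c, ?_⟩
      rw [map_div₀, ha, hc]
      field_simp
    rw [hbot, finrank_bot]
    apply finrank_eq_of_rank_eq
    rw [rank_functionalComap_inf_of_notMem hφ hker (powerSpan_subset_range hlam m) hα
      (hstab α hα hαK), ← finrank_eq_rank, ← finrank_eq_rank, hK, finrank_powerSpan (by omega)]
    obtain ⟨r, rfl⟩ : ∃ r, l = r + 1 := ⟨l - 1, by omega⟩
    push_cast
    ring

theorem ncard_finrank_functionalComap_inf [Fintype F] [Module.Finite K F] [Module.Finite Fq K]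
    (hφ : Function.Surjective φ) (hker : finrank K (LinearMap.ker φ) = l) (hl : 0 < l)
    (hstab : ∀ α : F, α ≠ 0 → α ∉ Set.range (algebraMap K F) →
      ¬ ∀ x, φ (α⁻¹ * x) = 0 ↔ φ x = 0)
    (hlam : lam ∈ Set.range (algebraMap K F)) (hm : 2 * m = (minpoly Fq lam).natDegree)
    (hK : finrank Fq K = 2 * m) {i : ℕ} (hi0 : 0 < i) (hi : i ≤ m) :
    ({α : F | α ≠ 0 ∧ finrank Fq ↥(functionalComap φ (powerSpan Fq lam m) ⊓
        smulSub Fq α (functionalComap φ (powerSpan Fq lam m))) = 2 * m * l + m - i}.ncard : ℤ) =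
      if i < m then (Nat.card Fq : ℤ) ^ (2 * i + 1) - (Nat.card Fq : ℤ) ^ (2 * i - 1)
      else (Nat.card F : ℤ) - (Nat.card Fq : ℤ) ^ (2 * i - 1) := by
  classical
  set r : F → ℕ := fun α =>
    finrank Fq ↥(powerSpan Fq lam m ⊓ smulSub Fq α (powerSpan Fq lam m)) with hr
  set A : ℕ → Finset F := fun j => Finset.univ.filter fun α => α ≠ 0 ∧ m < r α + j with hA
  have hcard : ∀ j, 0 < j → j ≤ m → ((A j).card : ℤ) = (Nat.card Fq : ℤ) ^ (2 * j - 1) - 1 :=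
    fun j h0 hj => card_lt_finrank_powerSpan_inf hm.le h0 hj
  have hset : ∀ B : Finset F, (∀ α, α ∈ B ↔ α ≠ 0 ∧ m < r α + (i + 1)) →
      {α : F | α ≠ 0 ∧ finrank Fq ↥(functionalComap φ (powerSpan Fq lam m) ⊓
        smulSub Fq α (functionalComap φ (powerSpan Fq lam m))) = 2 * m * l + m - i} =
      ↑(B \ A i) := by
    intro B hB
    ext α
    simp only [Set.mem_ofPred_eq, Finset.coe_sdiff, Set.mem_sdiff, Finset.mem_coe, hB, hA,
      Finset.mem_filter, Finset.mem_univ, true_and]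
    constructor
    · rintro ⟨h0, h⟩
      rw [finrank_functionalComap_inf hφ hker hl hstab hlam hm hK h0] at h
      change _ + r α = _ at h
      exact ⟨⟨h0, by omega⟩, fun h' => by omega⟩
    · rintro ⟨⟨h0, h⟩, h'⟩
      refine ⟨h0, ?_⟩
      rw [finrank_functionalComap_inf hφ hker hl hstab hlam hm hK h0]
      change _ + r α = _
      have : ¬ m < r α + i := fun h'' => h' ⟨h0, h''⟩
      omega
  split_ifs with him
  · rw [hset (A (i + 1)) (by simp [hA]), Set.ncard_coe_finset, Finset.cast_card_sdiff,
      hcard i hi0 hi, hcard (i + 1) (by omega) (by omega)]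
    · rw [show 2 * (i + 1) - 1 = 2 * i + 1 by omega]
      ring
    · intro α
      simp only [hA, Finset.mem_filter, Finset.mem_univ, true_and]
      exact fun h => ⟨h.1, by omega⟩
  · have hB : ∀ α : F, α ∈ Finset.univ.erase (0 : F) ↔ α ≠ 0 ∧ m < r α + (i + 1) := by
      intro α
      simp only [Finset.mem_erase, Finset.mem_univ, and_true]
      exact ⟨fun h => ⟨h, by omega⟩, fun h => h.1⟩
    rw [hset _ hB, Set.ncard_coe_finset, Finset.cast_card_sdiff, hcard i hi0 hi,
      Finset.cast_card_erase_of_mem (Finset.mem_univ _), Finset.card_univ,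
      Nat.card_eq_fintype_card (α := F)]
    · ring
    · intro α
      simp only [hA, Finset.mem_filter, Finset.mem_univ, true_and, Finset.mem_erase, and_true]
      exact fun h => h.1

theorem wt_eq_zero_of_forall_add [Infinite Fq] {S : Submodule Fq F}
    (hS : ∀ γ : F, γ ≠ 0 → smulSub Fq γ S = S → γ ∈ Fq) {v : ℕ} {x : F} (hx : x ∉ Fq)
    (h : ∀ c : Fq, finrank Fq ↥(S ⊓ smulSub Fq (x + c) S) = v) : wt Fq S v = 0 := by
  have hne : ∀ c : Fq, x + c ≠ 0 := fun c h0 =>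
    hx (by rw [eq_neg_of_add_eq_zero_left h0]; exact Fq.neg_mem c.2)
  refine Set.Infinite.ncard (Set.infinite_of_injective_forall_mem
    (f := fun c : Fq => smulSub Fq (x + c) S) ?_ fun c => ⟨⟨x + c, hne c, rfl⟩, h c⟩)
  intro c e hce
  have hmem := hS _ (mul_ne_zero (inv_ne_zero (hne e)) (hne c))
    (smulSub_inv_mul_eq_self (hne e) (hne c) hce)
  set γ := (x + e : F)⁻¹ * (x + c) with hγ
  have heq : γ * (x + e) = x + c := by
    rw [hγ]; field_simp [hne e]
  by_cases h1 : γ = 1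
  · rw [h1, one_mul, add_right_inj] at heq
    exact Subtype.ext heq.symm
  · exfalso
    have h1' : γ - 1 ≠ 0 := sub_ne_zero.2 h1
    apply hx
    have : x = (c - γ * e) / (γ - 1) := by
      rw [eq_div_iff h1']
      linear_combination heq
    rw [this]
    exact Fq.div_mem (Fq.sub_mem c.2 (Fq.mul_mem hmem e.2)) (Fq.sub_mem hmem Fq.one_mem)

theorem wt_functionalComap_eq_zero [Infinite Fq] [Module.Finite K F]
    (hφ : Function.Surjective φ) (hker : finrank K (LinearMap.ker φ) = l) (hl : 0 < l)
    (hstab : ∀ α : F, α ≠ 0 → α ∉ Set.range (algebraMap K F) →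
      ¬ ∀ x, φ (α⁻¹ * x) = 0 ↔ φ x = 0)
    (hlam : lam ∈ Set.range (algebraMap K F)) (hm0 : 0 < m)
    (hm : 2 * m = (minpoly Fq lam).natDegree) {i : ℕ} (hi0 : 0 < i) (hi : i ≤ m) :
    wt Fq (functionalComap φ (powerSpan Fq lam m)) (2 * m * l + m - i) = 0 := by
  set S := functionalComap φ (powerSpan Fq lam m) with hS
  have hSstab : ∀ γ : F, γ ≠ 0 → smulSub Fq γ S = S → γ ∈ Fq := fun γ hγ h =>
    mem_of_smulSub_functionalComap_eq hφ hstab hlam hm0 hm.le hγ h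
  have hnot : ∀ β : F, β ∉ Set.range (algebraMap K F) →
      wt Fq S (finrank Fq ↥(S ⊓ smulSub Fq β S)) = 0 := by
    intro β hβ
    refine wt_eq_zero_of_forall_add hSstab (fun h => hβ (coe_mem_range_algebraMap ⟨β, h⟩))
      fun c => ?_
    have hne : ∀ x : F, x ∉ Set.range (algebraMap K F) → x ≠ 0 := by
      rintro x hx rfl
      exact hx ⟨0, map_zero _⟩
    have hβc := (add_mem_range_algebraMap_iff (K := K) c).not.2 hβ
    rw [finrank, finrank, hS, rank_functionalComap_inf_of_notMem hφ hker
        (powerSpan_subset_range hlam m) (hne _ hβc) (hstab _ (hne _ hβc) hβc),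
      rank_functionalComap_inf_of_notMem hφ hker
        (powerSpan_subset_range hlam m) (hne _ hβ) (hstab _ (hne _ hβ) hβ)]
  have hpos : 2 * m * 1 ≤ 2 * m * l := Nat.mul_le_mul_left _ hl
  by_cases hemp : {T | T ∈ Orb Fq S ∧ finrank Fq ↥(S ⊓ T) = 2 * m * l + m - i} = ∅
  · rw [wt, hemp, Set.ncard_empty]
  obtain ⟨_, ⟨α, hα, rfl⟩, hv⟩ := Set.nonempty_iff_ne_empty.2 hemp
  by_cases hαK : α ∈ Set.range (algebraMap K F)
  swap
  · rw [← hv]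
    exact hnot α hαK
  have hrank := rank_functionalComap_inf_of_mem hφ hker (powerSpan_subset_range (Fq := Fq) hlam m)
    hα hαK
  have hfin : Module.Finite Fq K := by
    rw [← Module.rank_lt_aleph0_iff]
    by_contra! hinf
    have h0 : finrank Fq ↥(S ⊓ smulSub Fq α S) = 0 := by
      rw [finrank, Cardinal.toNat_apply_of_aleph0_le]
      rw [hrank]
      refine hinf.trans (le_trans ?_ le_add_self)
      exact le_mul_of_one_le_right' (by exact_mod_cast hl)
    omega
  have hK : finrank Fq K = 2 * m := by
    obtain ⟨a, rfl⟩ := hlam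
    rw [minpoly.algebraMap_eq (algebraMap K F).injective] at hm
    have hdvd := minpoly.degree_dvd (IsIntegral.of_finite Fq a)
    rw [← hm] at hdvd
    obtain ⟨s, hs⟩ := hdvd
    have hs0 : 0 < finrank Fq K := finrank_pos
    have hrank' := finrank_eq_of_rank_eq (n := finrank Fq ↥(powerSpan Fq (algebraMap K F a) m ⊓
      smulSub Fq α (powerSpan Fq (algebraMap K F a) m)) + finrank Fq K * l)
      (by rw [hrank, Nat.cast_add, Nat.cast_mul, finrank_eq_rank, finrank_eq_rank])
    change finrank Fq ↥(S ⊓ smulSub Fq α S) = _ at hrank'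
    rw [hv, hs] at hrank'
    rcases Nat.lt_or_ge s 2 with h2 | h2
    · interval_cases s
      · omega
      · omega
    · have : 2 * m * 2 * l ≤ 2 * m * s * l := by gcongr
      nlinarith [Nat.sub_le (2 * m * l + m) i]
  rcases hi.lt_or_eq with him | rfl
  · have hne : ∀ c : Fq, lam ^ i ≠ c := by
      intro c hc
      have h0 : (X ^ i - C c : Fq[X]) = 0 := by
        refine eq_zero_of_aeval_eq_zero (lam := lam) ?_ ?_
        · rw [degree_X_pow_sub_C hi0]
          exact_mod_cast (by omega)
        · rw [map_sub, map_pow, aeval_X, aeval_C, hc]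
          exact sub_self _
      exact X_pow_sub_C_ne_zero hi0 c h0
    refine wt_eq_zero_of_forall_add hSstab (x := lam ^ i) (fun h => hne ⟨_, h⟩ rfl) fun c => ?_
    have hne0 : lam ^ i + c ≠ 0 := fun h0 => hne (-c) (by
      rw [eq_neg_of_add_eq_zero_left h0]; rfl)
    rw [finrank_functionalComap_inf hφ hker hl hstab hlam hm hK hne0,
      finrank_powerSpan_inf_smulSub hm.le le_rfl hne0 (f := X ^ i + C c) (g := 1)
        (X_pow_add_C_ne_zero hi0 c) one_ne_zero isCoprime_one_right
        (by rwa [natDegree_X_pow_add_C]) (by rwa [natDegree_one])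
        (by rw [map_add, map_pow, aeval_X, aeval_C, map_one, mul_one]; rfl),
      natDegree_X_pow_add_C, natDegree_one]
    omega
  · obtain ⟨β, hβ⟩ : ∃ β : F, β ∉ Set.range (algebraMap K F) := by
      by_contra! hall
      have h1 := LinearMap.finrank_range_add_finrank_ker φ
      rw [LinearMap.range_eq_top.2 hφ, finrank_top, finrank_self] at h1
      have h2 := LinearMap.finrank_range_le (Algebra.linearMap K F)
      rw [LinearMap.range_eq_top.2 (show Function.Surjective (Algebra.linearMap K F) from hall),
        finrank_top, finrank_self] at h2
      omega
    have hβ0 : β ≠ 0 := by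
      rintro rfl
      exact hβ ⟨0, map_zero _⟩
    rw [← hnot β hβ, hS, finrank, rank_functionalComap_inf_of_notMem hφ hker
        (powerSpan_subset_range hlam i) hβ0 (hstab _ hβ0 hβ), ← finrank_eq_rank,
        ← finrank_eq_rank, finrank_powerSpan (by omega), hK]
    congr 1
    norm_cast
    obtain ⟨r, rfl⟩ : ∃ r, l = r + 1 := ⟨l - 1, by omega⟩
    rw [Nat.add_sub_cancel, Nat.add_sub_cancel]
    ring

end Weights

/-- suppose `Y = F`, `H(S̄) = F_{q^t}` and `2m = t` (the case `r = tl`).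
Then `ω_{2i} = (q+1)q^{2i-1}` for `i ∈ {1, …, m-1}` and `ω_{2m} = (q^n - q^{2m-1})/(q-1)`. -/
theorem stmt14 (q n : ℕ) (hn : 0 < n)
    (F : Type*) [Field F] (hF : Nat.card F = q ^ n)
    (Fq Fqt : Subfield F) (hq : Nat.card Fq = q) (hle : Fq ≤ Fqt)
    (lam : F) (hlam : lam ∉ Fq) (hmem : lam ∈ Fqt)
    (t : ℕ) (ht : t = (minpoly Fq lam).natDegree) (hqt : Nat.card Fqt = q ^ t)
    (l : ℕ) (hl : 0 < l)
    (Sbar : Submodule Fqt F) (hSbar : finrank Fqt Sbar = l)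
    (b : F) (hb : b ≠ 0)
    (hbint : {x : F | ∃ c ∈ Fqt, x = b * c} ∩ (Sbar : Set F) = {0})
    (m : ℕ) (hm1 : 0 < m) (hm2 : m < t)
    (Sm : Submodule Fq F) (hSm : Sm = Submodule.span Fq {x : F | ∃ j < m, x = lam ^ j})
    (S : Submodule Fq F) (hS : S = toFqSub Fq Fqt hle Sbar ⊔ smulSub Fq b Sm)
    (Y : Submodule Fq F)
    (hY : Y = toFqSub Fq Fqt hle Sbar ⊔ smulSub Fq b (subfieldModule Fq Fqt hle))
    (hYtop : Y = ⊤) (hnt : n = t * (l + 1))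
    (hHSbar : HStabSet (Sbar : Set F) = (Fqt : Set F))
    (hm : 2 * m = t) :
    (∀ i : ℕ, 1 ≤ i → i ≤ m - 1 →
        wt Fq S (t * l + m - i) = (q + 1) * q ^ (2 * i - 1)) ∧
      (wt Fq S (t * l) : ℚ) = ((q : ℚ) ^ n - (q : ℚ) ^ (2 * m - 1)) / ((q : ℚ) - 1) := by
  let : Algebra Fq Fqt := (Subfield.inclusion hle).toAlgebra
  have : IsScalarTower Fq Fqt F := IsScalarTower.of_algebraMap_eq fun _ => rfl
  have hrange : ∀ x : F, x ∈ Set.range (algebraMap Fqt F) ↔ x ∈ Fqt := fun x =>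
    ⟨fun ⟨y, hy⟩ => hy ▸ y.2, fun h => ⟨⟨x, h⟩, rfl⟩⟩
  have hlam' : lam ∈ Set.range (algebraMap Fqt F) := (hrange lam).2 hmem
  have hdecomp : ∀ x : F, ∃ s ∈ Sbar, ∃ c : Fqt, x = s + b * c := by
    intro x
    have hx : x ∈ Y := hYtop ▸ Submodule.mem_top
    rw [hY, Submodule.mem_sup] at hx
    obtain ⟨s, hs, _, ⟨c, hc, rfl⟩, rfl⟩ := hx
    exact ⟨s, hs, ⟨c, hc⟩, rfl⟩
  have hbS : b ∉ Sbar := by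
    intro h
    have : b ∈ ({0} : Set F) := hbint ▸ ⟨⟨1, Fqt.one_mem, (mul_one b).symm⟩, h⟩
    exact hb this
  obtain ⟨φ, hφb, hφS⟩ : ∃ φ : F →ₗ[Fqt] Fqt, φ b = 1 ∧ Sbar ≤ LinearMap.ker φ := by
    obtain ⟨f, hfb, hfS⟩ := Submodule.exists_le_ker_of_notMem hbS
    refine ⟨(f b)⁻¹ • f, by simp [hfb], fun x hx => ?_⟩
    have : f x = 0 := hfS hx
    simp [this]
  have hφdecomp : ∀ s ∈ Sbar, ∀ c : Fqt, φ (s + b * c) = c := by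
    intro s hs c
    have hs0 : φ s = 0 := hφS hs
    have hbc : b * c = c • b := mul_comm _ _
    rw [map_add, hs0, hbc, map_smul, hφb, zero_add, smul_eq_mul, mul_one]
  have hφ : Function.Surjective φ := fun c =>
    ⟨0 + b * c, hφdecomp 0 Sbar.zero_mem c⟩
  have hkerφ : LinearMap.ker φ = Sbar := by
    refine le_antisymm (fun x hx => ?_) hφS
    obtain ⟨s, hs, c, rfl⟩ := hdecomp x
    have hc : c = 0 := (hφdecomp s hs c).symm.trans hx
    simpa [hc] using hs
  have hker : finrank Fqt (LinearMap.ker φ) = l := by rw [hkerφ, hSbar]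
  have hfinker : Module.Finite Fqt (LinearMap.ker φ) :=
    FiniteDimensional.of_finrank_pos (by omega)
  have hfinF : Module.Finite Fqt F := by
    have : Module.Finite Fqt (F ⧸ LinearMap.ker φ) :=
      Module.Finite.equiv (φ.quotKerEquivOfSurjective hφ).symm
    exact Module.Finite.of_submodule_quotient (LinearMap.ker φ)
  have hSeq : S = functionalComap φ (powerSpan Fq lam m) := by
    rw [hS, hSm, span_pow_eq_powerSpan]
    ext x
    rw [mem_functionalComap, Submodule.mem_sup]
    constructor
    · rintro ⟨s, hs, _, ⟨u, hu, rfl⟩, rfl⟩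
      obtain ⟨c, rfl⟩ := powerSpan_subset_range hlam' m u hu
      have := hφdecomp s hs c
      change algebraMap Fqt F (φ (s + b * c)) ∈ _
      rwa [this]
    · intro hx
      obtain ⟨s, hs, c, rfl⟩ := hdecomp x
      rw [hφdecomp s hs c] at hx
      exact ⟨s, hs, _, ⟨c, hx, rfl⟩, rfl⟩
  have hstab : ∀ α : F, α ≠ 0 → α ∉ Set.range (algebraMap Fqt F) →
      ¬ ∀ x, φ (α⁻¹ * x) = 0 ↔ φ x = 0 := by
    intro α hα hαK h
    have hmemS : ∀ x, x ∈ Sbar ↔ φ x = 0 := fun x => by rw [← hkerφ, LinearMap.mem_ker]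
    apply hαK
    rw [hrange]
    have hα' : α ∈ HStabSet (Sbar : Set F) := by
      refine Or.inl ⟨hα, Set.ext fun x => ?_⟩
      constructor
      · rintro ⟨y, hy, rfl⟩
        have hy0 := (hmemS y).1 hy
        refine (hmemS _).2 ((h _).1 ?_)
        simpa [hα] using hy0
      · intro hx
        exact ⟨α⁻¹ * x, (hmemS _).2 ((h x).2 ((hmemS x).1 hx)), mul_inv_cancel_left₀ hα x⟩
    rwa [hHSbar] at hα'
  have hmt : 2 * m = (minpoly Fq lam).natDegree := hm.trans ht
  subst hSeq
  rcases Nat.eq_zero_or_pos q with hq0 | hqpos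
  · have hinf : Infinite Fq := by
      rcases Nat.card_eq_zero.1 (hq.trans hq0) with h | h
      · exact absurd ⟨0⟩ (not_nonempty_iff.2 h)
      · exact h
    have hzero : ∀ i, 0 < i → i ≤ m →
        wt Fq (functionalComap φ (powerSpan Fq lam m)) (2 * m * l + m - i) = 0 := fun i hi0 hi =>
      wt_functionalComap_eq_zero hφ hker hl hstab hlam' hm1 hmt hi0 hi
    rw [← hm]
    constructor
    · intro i hi0 hi
      rw [hzero i hi0 (by omega), hq0, zero_pow (by omega), mul_zero]
    · have h := hzero m hm1 le_rfl
      rw [Nat.add_sub_cancel] at h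
      rw [h, hq0]
      simp [zero_pow hn.ne', zero_pow (show 2 * m - 1 ≠ 0 by omega)]
  · have hFfin : Finite F := Nat.finite_of_card_ne_zero (by rw [hF]; positivity)
    have : Fintype F := Fintype.ofFinite F
    have hq1 : 1 < q := hq ▸ Finite.one_lt_card
    have hfinK : Module.Finite Fq Fqt := Module.Finite.of_finite
    have hK : finrank Fq Fqt = 2 * m := by
      have h := Module.natCard_eq_pow_finrank (K := Fq) (V := Fqt)
      rw [hqt, hq] at h
      rw [hm]
      exact (Nat.pow_right_injective hq1 h).symm
    have hwt : ∀ i, 0 < i → i ≤ m →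
        (wt Fq (functionalComap φ (powerSpan Fq lam m)) (2 * m * l + m - i) : ℤ) * ((q : ℤ) - 1) =
          if i < m then (q : ℤ) ^ (2 * i + 1) - (q : ℤ) ^ (2 * i - 1)
          else (q : ℤ) ^ n - (q : ℤ) ^ (2 * i - 1) := by
      intro i hi0 hi
      have h := wt_mul_card_sub_one (functionalComap φ (powerSpan Fq lam m))
        (fun γ hγ h => mem_of_smulSub_functionalComap_eq hφ hstab hlam' hm1 hmt.le hγ h)
        (2 * m * l + m - i)
      rw [ncard_finrank_functionalComap_inf hφ hker hl hstab hlam' hmt hK hi0 hi, hq, hF] at h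
      rw [h]
      push_cast
      rfl
    rw [← hm]
    constructor
    · intro i hi0 hi
      have h := hwt i hi0 (by omega)
      rw [if_pos (by omega)] at h
      have hq1' : (q : ℤ) - 1 ≠ 0 := by omega
      zify
      apply mul_right_cancel₀ hq1'
      rw [h, show 2 * i + 1 = (2 * i - 1) + 2 by omega]
      ring
    · have h := hwt m hm1 le_rfl
      rw [if_neg (lt_irrefl m), Nat.add_sub_cancel] at h
      have hq1' : (q : ℚ) - 1 ≠ 0 := by
        have : (1 : ℚ) < q := by exact_mod_cast hq1
        linarith
      rw [eq_div_iff hq1']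
      exact_mod_cast h
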